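/- arXiv:1902.07628 — 5 statements merged into one kernel-verified Lean document; each statement's English description precedes it below -/
import Mathlib

section
/- The supplementary code B_{u,m} has length n_B = (q^m - q^u)/(q-1), dimension n_B - m, and covering radius exactly 2. -/
/-- The distance from a vector `x` to a code `C`. -/
noncomputable def distToCode {F : Type} [Fintype F] [DecidableEq F] {n : ℕ}
    (C : Set (Fin n → F)) (x : Fin n → F) : ℕ :=
  sInf (Set.image (hammingDist x) C)

/-- The supplementary code `B_{u,m}`: the code whose parity-check matrix consists of
the `inr`-columns of `H`. -/
def suppCode {F : Type} [Field F] {m nu nB : ℕ}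
    (H : Matrix (Fin m) (Fin nu ⊕ Fin nB) F) : Submodule F (Fin nB → F) :=
  LinearMap.ker (Matrix.mulVecLin (Matrix.of fun i j => H i (Sum.inr j)))

theorem distToCode_le {F : Type} [Fintype F] [DecidableEq F] {n : ℕ}
    {C : Set (Fin n → F)} {x c : Fin n → F} (hc : c ∈ C) :
    distToCode C x ≤ hammingDist x c :=
  Nat.sInf_le (Set.mem_image_of_mem _ hc)

theorem exists_hammingDist_eq_distToCode {F : Type} [Fintype F] [DecidableEq F] {n : ℕ}
    {C : Set (Fin n → F)} (hC : C.Nonempty) (x : Fin n → F) :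
    ∃ c ∈ C, hammingDist x c = distToCode C x :=
  Nat.sInf_mem (hC.image (hammingDist x))

theorem hammingNorm_single_le_one {ι F : Type*} [Fintype ι] [DecidableEq ι] [Zero F]
    [DecidableEq F] (j : ι) (a : F) : hammingNorm (Pi.single j a : ι → F) ≤ 1 := by
  refine Finset.card_le_one.2 fun i hi k hk => ?_
  have eq_of_ne : ∀ i, (Pi.single j a : ι → F) i ≠ 0 → i = j := fun i hi => by
    by_contra h
    exact hi (Pi.single_eq_of_ne h _)
  rw [eq_of_ne i (Finset.mem_filter.1 hi).2, eq_of_ne k (Finset.mem_filter.1 hk).2]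

theorem hammingNorm_add_le {ι F : Type*} [Fintype ι] [AddGroup F] [DecidableEq F]
    (x y : ι → F) : hammingNorm (x + y) ≤ hammingNorm x + hammingNorm y := by
  classical
  refine (Finset.card_le_card fun i hi => ?_).trans (Finset.card_union_le _ _)
  simp only [Finset.mem_union, Finset.mem_filter, Finset.mem_univ, true_and, Pi.add_apply] at hi ⊢
  by_contra! h
  exact hi (by rw [h.1, h.2, add_zero])

theorem eq_zero_or_eq_single_of_hammingNorm_le_one {ι F : Type*} [Fintype ι] [DecidableEq ι]
    [Zero F] [DecidableEq F] {y : ι → F} (hy : hammingNorm y ≤ 1) :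
    y = 0 ∨ ∃ j, y = Pi.single j (y j) := by
  by_cases h0 : y = 0
  · exact Or.inl h0
  obtain ⟨j, hj⟩ := Function.ne_iff.1 h0
  refine Or.inr ⟨j, funext fun i => ?_⟩
  by_cases hij : i = j
  · subst hij
    simp
  rw [Pi.single_eq_of_ne hij]
  by_contra hi
  exact hij (Finset.card_le_one.1 hy i (by simpa using hi) j (by simpa using hj))

/-- If every nonzero vector is a multiple of a column of `H`, and the `inl`-columns all vanish
in a common coordinate, then every vector is a combination of at most two `inr`-columns. -/
theorem exists_hammingNorm_le_two_mulVec_eq {F : Type} [Field F] [DecidableEq F]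
    {m nu nB : ℕ} (H : Matrix (Fin m) (Fin nu ⊕ Fin nB) F)
    (hmax : ∀ v : Fin m → F, v ≠ 0 → ∃ j, ∃ a : F, v = fun i => a * H i j)
    (i₀ : Fin m) (hvan : ∀ j : Fin nu, H i₀ (Sum.inl j) = 0) (s : Fin m → F) :
    ∃ y : Fin nB → F, hammingNorm y ≤ 2 ∧
      (Matrix.of fun i j => H i (Sum.inr j)).mulVec y = s := by
  have single_col : ∀ v : Fin m → F, v i₀ ≠ 0 → ∃ y : Fin nB → F, hammingNorm y ≤ 1 ∧
      (Matrix.of fun i j => H i (Sum.inr j)).mulVec y = v := by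
    intro v hv
    obtain ⟨j | j, a, rfl⟩ := hmax v (fun h => hv (by rw [h]; rfl))
    · exact absurd (by simp [hvan]) hv
    · refine ⟨Pi.single j a, hammingNorm_single_le_one j a, ?_⟩
      ext i
      simp [Matrix.mulVec_single, mul_comm]
  by_cases hs : s i₀ = 0
  · obtain ⟨y, hy, hys⟩ := single_col (s - Pi.single i₀ 1) (by simp [hs])
    obtain ⟨z, hz, hzs⟩ := single_col (Pi.single i₀ 1) (by simp)
    refine ⟨y + z, (hammingNorm_add_le y z).trans (by omega), ?_⟩
    rw [Matrix.mulVec_add, hys, hzs, sub_add_cancel]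
  · obtain ⟨y, hy, hys⟩ := single_col s hs
    exact ⟨y, hy.trans one_le_two, hys⟩

/-- `B_{u,m}` has length `n_B = (q^m - q^u)/(q-1)`, dimension `n_B - m`
and covering radius exactly 2. -/
theorem supplementary_code_parameters
    {F : Type} [Field F] [Fintype F] [DecidableEq F]
    (q m u nu nB : ℕ) (hq : Fintype.card F = q) (hm : 1 < m)
    (hu1 : 1 ≤ u) (hum : u ≤ m - 1)
    (hnu : nu * (q - 1) = q ^ u - 1)
    (hn : (nu + nB) * (q - 1) = q ^ m - 1)
    (H : Matrix (Fin m) (Fin nu ⊕ Fin nB) F)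
    (hcols : ∀ j, (fun i => H i j) ≠ 0)
    (hindep : ∀ j k, j ≠ k → ∀ a : F, (fun i => a * H i j) ≠ (fun i => H i k))
    (hmax : ∀ v : Fin m → F, v ≠ 0 → ∃ j, ∃ a : F, v = fun i => a * H i j)
    (hvan : ∀ j : Fin nu, ∀ i : Fin m, u ≤ (i : ℕ) → H i (Sum.inl j) = 0) :
    nB * (q - 1) = q ^ m - q ^ u ∧
      Module.finrank F (suppCode H) = nB - m ∧
      (∀ x, distToCode ((suppCode H : Submodule F (Fin nB → F)) : Set (Fin nB → F)) x ≤ 2) ∧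
      (∃ x, distToCode ((suppCode H : Submodule F (Fin nB → F)) : Set (Fin nB → F)) x = 2) := by
  have hq2 : 1 < q := hq ▸ Fintype.one_lt_card
  have hcomb := exists_hammingNorm_le_two_mulVec_eq H hmax ⟨u, by omega⟩
    (fun j => hvan j _ le_rfl)
  have hdist : ∀ x, distToCode ((suppCode H : Submodule F (Fin nB → F)) :
      Set (Fin nB → F)) x ≤ 2 := by
    intro x
    obtain ⟨y, hy, hys⟩ := hcomb ((Matrix.of fun i j => H i (Sum.inr j)).mulVec x)
    have hmem : x - y ∈ suppCode H := by
      simp [suppCode, Matrix.mulVec_sub, hys]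
    refine (distToCode_le hmem).trans ?_
    rwa [hammingDist_comm, hammingDist_eq_hammingNorm, neg_add_eq_sub, sub_sub_cancel]
  refine ⟨?_, ?_, hdist, ?_⟩
  · have hu0 : 1 ≤ q ^ u := Nat.one_le_pow _ _ (by omega)
    rw [add_mul] at hn
    omega
  · have hsurj : LinearMap.range
        (Matrix.mulVecLin (Matrix.of fun i j => H i (Sum.inr j))) = ⊤ :=
      LinearMap.range_eq_top.2 fun s => (hcomb s).imp fun _ h => h.2
    have hrank := LinearMap.finrank_range_add_finrank_ker
      (Matrix.mulVecLin (Matrix.of fun i j => H i (Sum.inr j)))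
    rw [hsurj, finrank_top, Module.finrank_fin_fun, Module.finrank_fin_fun] at hrank
    rw [suppCode]
    omega
  · have hnu_pos : 0 < nu := by
      have hqu : 1 < q ^ u := Nat.one_lt_pow (by omega) hq2
      refine Nat.pos_of_ne_zero fun h => ?_
      rw [h, zero_mul] at hnu
      omega
    obtain ⟨x, -, hx⟩ := hcomb fun i => H i (Sum.inl ⟨0, hnu_pos⟩)
    refine ⟨x, (hdist x).antisymm ?_⟩
    by_contra! hlt
    obtain ⟨c, hc, hxc⟩ := exists_hammingDist_eq_distToCode
      (C := (suppCode H : Set (Fin nB → F))) ⟨0, (suppCode H).zero_mem⟩ x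
    have hc0 : (Matrix.of fun i j => H i (Sum.inr j)).mulVec c = 0 := hc
    have hsynd : (Matrix.of fun i j => H i (Sum.inr j)).mulVec (x - c) =
        fun i => H i (Sum.inl ⟨0, hnu_pos⟩) := by
      rw [Matrix.mulVec_sub, hx, hc0, sub_zero]
    have hnorm : hammingNorm (x - c) ≤ 1 := by
      rw [hammingDist_comm, hammingDist_eq_hammingNorm, neg_add_eq_sub] at hxc
      omega
    rcases eq_zero_or_eq_single_of_hammingNorm_le_one hnorm with h | ⟨j, h⟩
    · rw [h, Matrix.mulVec_zero] at hsynd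
      exact hcols _ hsynd.symm
    · rw [h] at hsynd
      refine hindep (Sum.inr j) (Sum.inl ⟨0, hnu_pos⟩) (by simp) ((x - c) j) ?_
      rw [← hsynd]
      ext i
      simp [Matrix.mulVec_single, mul_comm]
end

section
/- In the case q = 2 and u = m-1, the supplementary code B_{m-1,m} is (equivalent to) the extended binary Hamming code of length 2^{m-1}. -/
/-- Injectively indexed nonzero vectors of `ZMod 2 ^ n` exhaust all of them when there are
`2 ^ n - 1` of them. -/
theorem exists_eq_of_injective_of_ne_zero {n k : ℕ} (hk : k = 2 ^ n - 1)
    {c : Fin k → Fin n → ZMod 2} (hc : Function.Injective c) (hc0 : ∀ j, c j ≠ 0)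
    {v : Fin n → ZMod 2} (hv : v ≠ 0) : ∃ j, c j = v := by
  have hcard : Fintype.card (Fin k) = Fintype.card {v : Fin n → ZMod 2 // v ≠ 0} := by
    rw [Fintype.card_subtype_compl]
    simp [ZMod.card, hk]
  have hinj : Function.Injective fun j => (⟨c j, hc0 j⟩ : {v : Fin n → ZMod 2 // v ≠ 0}) :=
    fun i j h => hc (congrArg Subtype.val h)
  obtain ⟨j, hj⟩ := ((Fintype.bijective_iff_injective_and_card _).2 ⟨hinj, hcard⟩).2 ⟨v, hv⟩
  exact ⟨j, congrArg Subtype.val hj⟩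

/-- If the vectors indexed by `Fin nB` are all of `ZMod 2 ^ n` and those indexed by `Fin nu` are
all the nonzero ones, each occurring once, then the two index sets (the second one with an extra
index for the zero vector) can be matched. -/
theorem exists_equiv_of_columns {n nu nB : ℕ} {c : Fin nu → Fin n → ZMod 2}
    (hc : Function.Injective c) (hc0 : ∀ j, c j ≠ 0) (hcs : ∀ v, v ≠ 0 → ∃ j, c j = v)
    {b : Fin nB → Fin n → ZMod 2} (hb : Function.Bijective b) :
    ∃ e : Fin nB ≃ Fin (nu + 1),
      (∀ j : Fin nu, b (e.symm j.castSucc) = c j) ∧ b (e.symm (Fin.last nu)) = 0 := by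
  have hd : Function.Bijective (Fin.snoc c 0 : Fin (nu + 1) → Fin n → ZMod 2) := by
    refine ⟨Fin.snoc_injective_iff.2 ⟨hc, fun ⟨j, hj⟩ => hc0 j hj⟩, fun v => ?_⟩
    by_cases hv : v = 0
    · exact ⟨Fin.last nu, by simp [hv]⟩
    · obtain ⟨j, hj⟩ := hcs v hv
      exact ⟨j.castSucc, by simp [hj]⟩
  refine ⟨(Equiv.ofBijective b hb).trans (Equiv.ofBijective _ hd).symm, fun j => ?_, ?_⟩
  · simpa using Equiv.ofBijective_apply_symm_apply b hb (c j)
  · simpa using Equiv.ofBijective_apply_symm_apply b hb 0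

/-- Membership in the supplementary code, when the columns of its parity-check matrix are those of
`H'` and the zero column, on top of an all-ones row. -/
theorem mem_suppCode_iff_of_columns {F : Type} [Field F] {n nu nB : ℕ}
    {H : Matrix (Fin (n + 1)) (Fin nu ⊕ Fin nB) F} {H' : Matrix (Fin n) (Fin nu) F}
    (e : Fin nB ≃ Fin (nu + 1)) (hlast : ∀ j, H (Fin.last n) (Sum.inr j) = 1)
    (he : ∀ i j, H (Fin.castSucc i) (Sum.inr (e.symm (Fin.castSucc j))) = H' i j)
    (he0 : ∀ i, H (Fin.castSucc i) (Sum.inr (e.symm (Fin.last nu))) = 0) (x : Fin nB → F) :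
    x ∈ suppCode H ↔
      ((fun j : Fin nu => x (e.symm j.castSucc)) ∈ LinearMap.ker (Matrix.mulVecLin H') ∧
        ∑ j : Fin (nu + 1), x (e.symm j) = 0) := by
  have hsum : ∀ i, ∑ j, H i (Sum.inr j) * x j =
      ∑ k, H i (Sum.inr (e.symm k)) * x (e.symm k) :=
    fun i => (e.symm.sum_comp fun j => H i (Sum.inr j) * x j).symm
  simp only [suppCode, LinearMap.mem_ker, Matrix.mulVecLin_apply, funext_iff, Matrix.mulVec,
    dotProduct, Matrix.of_apply, Pi.zero_apply, hsum]
  rw [Fin.forall_fin_succ']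
  refine and_congr (forall_congr' fun i => ?_) ?_
  · rw [Fin.sum_univ_castSucc]
    simp [he, he0]
  · simp [hlast]

/-- for `q = 2` and `u = m - 1`, the supplementary code `B_{m-1,m}` is
(up to a permutation of coordinates) the extended binary Hamming code of length
`2^(m-1)`, i.e. the code obtained from a binary Hamming code of length `2^(m-1)-1`
by adding an overall parity-check coordinate. -/
theorem supplementary_code_is_extended_hamming
    (m nu nB : ℕ) (hm : 2 < m)
    (hnu : nu = 2 ^ (m - 1) - 1)
    (hn : nu + nB = 2 ^ m - 1)
    (H : Matrix (Fin m) (Fin nu ⊕ Fin nB) (ZMod 2))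
    (hcols : ∀ j, (fun i => H i j) ≠ 0)
    (hindep : ∀ j k, j ≠ k → ∀ a : ZMod 2, (fun i => a * H i j) ≠ (fun i => H i k))
    (hmax : ∀ v : Fin m → ZMod 2, v ≠ 0 → ∃ j, ∃ a : ZMod 2, v = fun i => a * H i j)
    (hvan : ∀ j : Fin nu, ∀ i : Fin m, m - 1 ≤ (i : ℕ) → H i (Sum.inl j) = 0) :
    ∃ H' : Matrix (Fin (m - 1)) (Fin nu) (ZMod 2),
      -- H' is a parity-check matrix of the binary Hamming code of length 2^(m-1)-1
      (∀ j, (fun i => H' i j) ≠ 0) ∧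
      (∀ j k, j ≠ k → ∀ a : ZMod 2, (fun i => a * H' i j) ≠ (fun i => H' i k)) ∧
      (∀ v : Fin (m - 1) → ZMod 2, v ≠ 0 → ∃ j, ∃ a : ZMod 2, v = fun i => a * H' i j) ∧
      -- a coordinate permutation identifying B_{m-1,m} with the extension of ker H'
      ∃ e : Fin nB ≃ Fin (nu + 1),
        ∀ x : Fin nB → ZMod 2,
          x ∈ suppCode H ↔
            ((fun j : Fin nu => x (e.symm j.castSucc)) ∈
                LinearMap.ker (Matrix.mulVecLin H') ∧
              ∑ j : Fin (nu + 1), x (e.symm j) = 0) := by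
 
  obtain ⟨n, rfl⟩ : ∃ n, m = n + 1 := ⟨m - 1, by omega⟩
  simp only [Nat.add_sub_cancel] at hnu hvan ⊢
  have two : ∀ a : ZMod 2, a = 0 ∨ a = 1 := by decide
  have hne : ∀ j k, (∀ i, H i j = H i k) → j = k := fun j k h => by
    by_contra hjk
    exact hindep j k hjk 1 (funext fun i => by simp [h i])
  have hsurj : ∀ v : Fin (n + 1) → ZMod 2, v ≠ 0 → ∃ j, ∀ i, H i j = v i := fun v hv => by
    obtain ⟨j, a, h⟩ := hmax v hv
    rcases two a with rfl | rfl
    · exact absurd (by rw [h]; ext i; simp) hv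
    · exact ⟨j, fun i => by simp [h]⟩
  have hl : ∀ j, H (Fin.last n) (Sum.inl j) = 0 := fun j => hvan j _ (by simp)
  let c : Fin nu → Fin n → ZMod 2 := fun j i => H i.castSucc (Sum.inl j)
  have hc : Function.Injective c := fun j k h => Sum.inl_injective <| hne _ _ fun i => by
    induction i using Fin.lastCases with
    | last => rw [hl, hl]
    | cast i => exact congrFun h i
  have hc0 : ∀ j, c j ≠ 0 := fun j h => hcols (Sum.inl j) <| funext fun i => by
    induction i using Fin.lastCases with
    | last => exact hl j
    | cast i => exact congrFun h i
  have hcs : ∀ v, v ≠ 0 → ∃ j, c j = v := fun v => exists_eq_of_injective_of_ne_zero hnu hc hc0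
  have hr : ∀ j, H (Fin.last n) (Sum.inr j) = 1 := fun j => by
    refine (two _).resolve_left fun h0 => ?_
    have hv : (fun i : Fin n => H i.castSucc (Sum.inr j)) ≠ 0 := fun h =>
      hcols (Sum.inr j) <| funext fun i => by
        induction i using Fin.lastCases with
        | last => exact h0
        | cast i => exact congrFun h i
    obtain ⟨k, hk⟩ := hcs _ hv
    refine Sum.inl_ne_inr (hne (Sum.inl k) (Sum.inr j) fun i => ?_)
    induction i using Fin.lastCases with
    | last => rw [hl, h0]
    | cast i => exact congrFun hk i
  let b : Fin nB → Fin n → ZMod 2 := fun j i => H i.castSucc (Sum.inr j)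
  have hb : Function.Bijective b := by
    refine ⟨fun j k h => Sum.inr_injective <| hne _ _ fun i => ?_, fun v => ?_⟩
    · induction i using Fin.lastCases with
      | last => rw [hr, hr]
      | cast i => exact congrFun h i
    · obtain ⟨j | j, hj⟩ := hsurj (Fin.snoc v 1) fun h => by
        simpa using congrFun h (Fin.last n)
      · simpa [hl] using hj (Fin.last n)
      · exact ⟨j, funext fun i => by simpa using hj i.castSucc⟩
  obtain ⟨e, he, he0⟩ := exists_equiv_of_columns hc hc0 hcs hb
  refine ⟨Matrix.of fun i j => c j i, hc0, fun j k hjk a h => ?_, fun v hv => ?_, e,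
    mem_suppCode_iff_of_columns e hr (fun i j => congrFun (he j) i) (congrFun he0)⟩
  · rcases two a with rfl | rfl
    · exact hc0 k (funext fun i => by simpa using (congrFun h i).symm)
    · exact hjk (hc (funext fun i => by simpa using congrFun h i))
  · obtain ⟨j, rfl⟩ := hcs v hv
    exact ⟨j, 1, by simp⟩
end

section
/- Every vector x' ∈ F_q^{n_B} lying in a coset of B_{u,m} of minimum weight 2 satisfies: the vector (0 | x') ∈ F_q^{n_m} (zero on the first n_u coordinates) lies in a coset of the Hamming code H_m of minimum weight 1 whose leader e_j has its nonzero coordinate at a position j ∈ {1,…,n_u}. -/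
/-- if `x'` lies in a coset of `B_{u,m}` of minimum weight 2 (i.e. it is
at distance 2 from `B_{u,m}`), then `(0 | x')` lies in a coset of the Hamming code
whose leader is a weight-one vector supported at one of the first `n_u` positions;
that is, `(0 | x') + a·e_{inl j} ∈ H_m` for some `j ∈ Fin n_u` and nonzero `a`. -/
theorem weight_two_coset_leaders
    {F : Type} [Field F] [Fintype F] [DecidableEq F]
    (q m u nu nB : ℕ) (hq : Fintype.card F = q) (hm : 1 < m)
    (hu1 : 1 ≤ u) (hum : u ≤ m - 1)
    (hnu : nu * (q - 1) = q ^ u - 1)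
    (hn : (nu + nB) * (q - 1) = q ^ m - 1)
    (H : Matrix (Fin m) (Fin nu ⊕ Fin nB) F)
    (hcols : ∀ j, (fun i => H i j) ≠ 0)
    (hindep : ∀ j k, j ≠ k → ∀ a : F, (fun i => a * H i j) ≠ (fun i => H i k))
    (hmax : ∀ v : Fin m → F, v ≠ 0 → ∃ j, ∃ a : F, v = fun i => a * H i j)
    (hvan : ∀ j : Fin nu, ∀ i : Fin m, u ≤ (i : ℕ) → H i (Sum.inl j) = 0)
    (x' : Fin nB → F)
    (hx' : distToCode ((suppCode H : Submodule F (Fin nB → F)) : Set (Fin nB → F)) x' = 2) :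
    ∃ j : Fin nu, ∃ a : F, a ≠ 0 ∧
      (Sum.elim (fun k : Fin nu => if k = j then a else 0) x' : Fin nu ⊕ Fin nB → F)
        ∈ LinearMap.ker (Matrix.mulVecLin H) := by
  have hdist : ∀ c ∈ suppCode H, 2 ≤ hammingDist x' c := fun c hc => by
    rw [← hx']
    exact Nat.sInf_le ⟨c, hc, rfl⟩
  have hmem : ∀ c : Fin nB → F,
      c ∈ suppCode H ↔ ∀ i, ∑ k, H i (Sum.inr k) * c k = 0 := fun c => by
    simp [suppCode, LinearMap.mem_ker, funext_iff, Matrix.mulVec, dotProduct]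
  have hs : (fun i => -∑ k, H i (Sum.inr k) * x' k) ≠ 0 := fun h => by
    have := hdist x' ((hmem x').2 fun i => by simpa using congrFun h i)
    simp at this
  obtain ⟨j, a, ha⟩ := hmax _ hs
  have ha0 : a ≠ 0 := by
    rintro rfl
    exact hs (ha.trans (by ext; simp))
  rcases j with j | k
  · refine ⟨j, a, ha0, ?_⟩
    rw [LinearMap.mem_ker]
    ext i
    have hi := congrFun ha i
    simp only [Matrix.mulVecLin_apply, Matrix.mulVec, dotProduct, Fintype.sum_sum_type,
      Sum.elim_inl, Sum.elim_inr, mul_ite, mul_zero, Finset.sum_ite_eq', Finset.sum_ite_eq,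
      Finset.mem_univ, if_true, Pi.zero_apply] at hi ⊢
    linear_combination -hi
  · have hc : x' + Pi.single k a ∈ suppCode H := (hmem _).2 fun i => by
      have hi := congrFun ha i
      simp only [Pi.add_apply, mul_add, Finset.sum_add_distrib, Pi.single_apply, mul_ite,
        mul_zero, Finset.sum_ite_eq', Finset.mem_univ, if_true]
      linear_combination -hi
    have hle : hammingDist x' (x' + Pi.single k a) ≤ 1 := by
      refine (Finset.card_le_card (t := {k}) fun l hl => ?_).trans (Finset.card_singleton k).le
      by_contra hlk
      simp_all [Pi.single_apply]
    have := hdist _ hc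
    omega
end

section
/- Suppose A and B are supplementary codes from a parity-check matrix of the q-ary Hamming code of length n_m, A is completely regular of dimension n_A - m with covering radius 2 and intersection array {b_0, b_1; c_1, c_2}, and B also has covering radius 2. Then B has dimension n_B - m. -/
/-- `C` is completely regular with covering radius `ρ` and intersection numbers
`b`, `c`. -/
def IsCompletelyRegular {F : Type} [Fintype F] [DecidableEq F] {n : ℕ}
    (C : Set (Fin n → F)) (ρ : ℕ) (b c : ℕ → ℕ) : Prop :=
  (∀ x, distToCode C x ≤ ρ) ∧ (∃ x, distToCode C x = ρ) ∧
  (∀ l ≤ ρ, ∀ x, distToCode C x = l →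
    Nat.card {y : Fin n → F | hammingDist x y = 1 ∧ distToCode C y = l + 1} = b l ∧
    (1 ≤ l →
      Nat.card {y : Fin n → F | hammingDist x y = 1 ∧ distToCode C y = l - 1} = c l))

/-- The code with parity-check matrix the `inl`-columns of `H`. -/
def codeA {F : Type} [Field F] {m nA nB : ℕ}
    (H : Matrix (Fin m) (Fin nA ⊕ Fin nB) F) : Submodule F (Fin nA → F) :=
  LinearMap.ker (Matrix.mulVecLin (Matrix.of fun i j => H i (Sum.inl j)))

/-- The supplementary code, with parity-check matrix the `inr`-columns of `H`. -/
def codeB {F : Type} [Field F] {m nA nB : ℕ}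
    (H : Matrix (Fin m) (Fin nA ⊕ Fin nB) F) : Submodule F (Fin nB → F) :=
  LinearMap.ker (Matrix.mulVecLin (Matrix.of fun i j => H i (Sum.inr j)))

theorem mulVec_single_eq {F : Type} [Field F] {m n : ℕ}
    (G : Matrix (Fin m) (Fin n) F) (j : Fin n) (a : F) :
    G.mulVec (Pi.single j a) = fun i => a * G i j := by
  rw [Matrix.mulVec_single]
  funext i
  simp [mul_comm]

theorem hammingNorm_single {F : Type} [Field F] [DecidableEq F] {n : ℕ}
    {j : Fin n} {a : F} (ha : a ≠ 0) :
    hammingNorm (Pi.single j a : Fin n → F) = 1 := by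
  unfold hammingNorm
  rw [Finset.card_eq_one]
  refine ⟨j, ?_⟩
  ext k
  by_cases h : k = j
  · subst h; simp [ha]
  · simp [h]

theorem exists_single_of_hammingNorm_eq_one {F : Type} [Field F] [DecidableEq F] {n : ℕ}
    {e : Fin n → F} (he : hammingNorm e = 1) :
    ∃ j, ∃ a : F, a ≠ 0 ∧ e = Pi.single j a := by
  unfold hammingNorm at he
  obtain ⟨j, hj⟩ := Finset.card_eq_one.1 he
  have h : ∀ k, e k ≠ 0 ↔ k = j := fun k => by
    simpa using Finset.ext_iff.1 hj k
  refine ⟨j, e j, (h j).2 rfl, ?_⟩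
  funext k
  by_cases hk : k = j
  · subst hk; simp
  · simpa [hk] using (h k).not.2 hk

theorem exists_single_of_hammingDist_eq_one {F : Type} [Field F] [DecidableEq F] {n : ℕ}
    {x y : Fin n → F} (hxy : hammingDist x y = 1) :
    ∃ j, ∃ a : F, a ≠ 0 ∧ y = x + Pi.single j a := by
  rw [hammingDist_eq_hammingNorm] at hxy
  obtain ⟨j, a, ha, h⟩ := exists_single_of_hammingNorm_eq_one hxy
  exact ⟨j, a, ha, by rw [← h, add_neg_cancel_left]⟩

theorem hammingDist_add_single {F : Type} [Field F] [DecidableEq F] {n : ℕ}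
    (x : Fin n → F) {j : Fin n} {a : F} (ha : a ≠ 0) :
    hammingDist x (x + Pi.single j a) = 1 := by
  rw [hammingDist_eq_hammingNorm, neg_add_cancel_left, hammingNorm_single ha]

theorem distToCode_eq_zero_iff {F : Type} [Field F] [Fintype F] [DecidableEq F] {m n : ℕ}
    (G : Matrix (Fin m) (Fin n) F) (x : Fin n → F) :
    distToCode (LinearMap.ker G.mulVecLin : Set (Fin n → F)) x = 0 ↔ G.mulVec x = 0 := by
  unfold distToCode
  rw [Nat.sInf_eq_zero]
  constructor
  · rintro (⟨c, hc, h⟩ | h)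
    · rw [hammingDist_eq_zero] at h
      subst h
      simpa using hc
    · exact absurd h (Set.Nonempty.ne_empty ⟨_, 0, by simp, rfl⟩)
  · intro h
    exact Or.inl ⟨x, by simpa using h, hammingDist_self x⟩

theorem distToCode_le_one_iff {F : Type} [Field F] [Fintype F] [DecidableEq F] {m n : ℕ}
    (hn : 1 ≤ n) (G : Matrix (Fin m) (Fin n) F) (x : Fin n → F) :
    distToCode (LinearMap.ker G.mulVecLin : Set (Fin n → F)) x ≤ 1 ↔
      ∃ j, ∃ a : F, G.mulVec x = fun i => a * G i j := by
  constructor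
  · intro h
    obtain ⟨c, hc, hd⟩ := Nat.sInf_mem (s := Set.image (hammingDist x)
      (LinearMap.ker G.mulVecLin : Set (Fin n → F))) ⟨_, 0, by simp, rfl⟩
    have hc0 : G.mulVec c = 0 := by simpa using hc
    have hle : hammingDist x c ≤ 1 := hd.trans_le h
    obtain h0 | h1 := Nat.le_one_iff_eq_zero_or_eq_one.1 hle
    · rw [hammingDist_eq_zero] at h0
      subst h0
      refine ⟨⟨0, hn⟩, 0, ?_⟩
      rw [hc0]
      funext i
      simp
    · rw [hammingDist_comm] at h1
      obtain ⟨j, a, -, rfl⟩ := exists_single_of_hammingDist_eq_one h1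
      exact ⟨j, a, by rw [Matrix.mulVec_add, hc0, zero_add, mulVec_single_eq]⟩
  · rintro ⟨j, a, h⟩
    have hmem : x - Pi.single j a ∈ (LinearMap.ker G.mulVecLin : Set (Fin n → F)) := by
      simp only [SetLike.mem_coe, LinearMap.mem_ker, Matrix.mulVecLin_apply]
      rw [Matrix.mulVec_sub, h, mulVec_single_eq, sub_self]
    refine (Nat.sInf_le (Set.mem_image_of_mem (hammingDist x) hmem)).trans ?_
    rw [hammingDist_comm, hammingDist_eq_hammingNorm, neg_sub, sub_add_cancel]
    by_cases ha : a = 0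
    · simp [ha]
    · exact (hammingNorm_single ha).le

/-- A parity-check matrix with nonzero, pairwise non-proportional columns has injective syndrome
map on each sphere of radius one. -/
theorem mulVec_injOn_sphere {F : Type} [Field F] [DecidableEq F] {m n : ℕ}
    (G : Matrix (Fin m) (Fin n) F) (hcols : ∀ j, (fun i => G i j) ≠ 0)
    (hindep : ∀ j k, j ≠ k → ∀ a : F, (fun i => a * G i j) ≠ (fun i => G i k)) (x : Fin n → F) :
    Set.InjOn G.mulVec {y | hammingDist x y = 1} := by
  intro y hy z hz h
  obtain ⟨j, a, ha, rfl⟩ := exists_single_of_hammingDist_eq_one hy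
  obtain ⟨k, b, hb, rfl⟩ := exists_single_of_hammingDist_eq_one hz
  simp only [Matrix.mulVec_add, add_right_inj, mulVec_single_eq] at h
  by_cases hjk : j = k
  · subst hjk
    obtain ⟨i, hi⟩ := Function.ne_iff.1 (hcols j)
    rw [mul_right_cancel₀ hi (congrFun h i)]
  · refine absurd ?_ (hindep j k hjk (b⁻¹ * a))
    funext i
    rw [mul_assoc, congrFun h i, inv_mul_cancel_left₀ hb]

/-- If some vector is at distance at least two from the code, then the set of multiples of columns
of the parity-check matrix is not closed under addition. -/
theorem exists_add_not_multiple_of_distToCode {F : Type} [Field F] [Fintype F] [DecidableEq F] {m n : ℕ}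
    (hn : 1 ≤ n) (G : Matrix (Fin m) (Fin n) F)
    {x : Fin n → F} (hx : 1 < distToCode (LinearMap.ker G.mulVecLin : Set (Fin n → F)) x) :
    ∃ s t : Fin m → F, (∃ j, ∃ a : F, s = fun i => a * G i j) ∧
      (∃ j, ∃ a : F, t = fun i => a * G i j) ∧ ¬ ∃ j, ∃ a : F, s + t = fun i => a * G i j := by
  by_contra! hadd
  refine hx.not_ge ((distToCode_le_one_iff hn G x).2 ?_)
  rw [← Finset.univ_sum_single x, Matrix.mulVec_sum]
  refine Finset.sum_induction _ (fun v => ∃ j, ∃ a : F, v = fun i => a * G i j) ?_ ?_ ?_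
  · rintro s t ⟨j, a, hs⟩ ⟨k, b, ht⟩
    by_contra! hst
    obtain ⟨l, c, h⟩ := hadd s t ⟨j, a, hs⟩ ⟨k, b, ht⟩
    exact hst l c h
  · exact ⟨⟨0, hn⟩, 0, by funext i; simp⟩
  · exact fun j _ => ⟨j, x j, mulVec_single_eq G j (x j)⟩

/-- if `A` is completely regular of dimension `n_A - m` with covering
radius 2 and the supplementary code `B` also has covering radius 2, then `B` has
dimension `n_B - m`. -/
theorem supplementary_code_dimension
    {F : Type} [Field F] [Fintype F] [DecidableEq F]
    (q m nA nB : ℕ) (hq : Fintype.card F = q) (hm : 1 < m)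
    (hA : 1 ≤ nA) (hB : 1 ≤ nB)
    (hn : (nA + nB) * (q - 1) = q ^ m - 1)
    (H : Matrix (Fin m) (Fin nA ⊕ Fin nB) F)
    (hcols : ∀ j, (fun i => H i j) ≠ 0)
    (hindep : ∀ j k, j ≠ k → ∀ a : F, (fun i => a * H i j) ≠ (fun i => H i k))
    (hmax : ∀ v : Fin m → F, v ≠ 0 → ∃ j, ∃ a : F, v = fun i => a * H i j)
    (hdimA : Module.finrank F (codeA H) = nA - m)
    (hCRA : ∃ b c : ℕ → ℕ,
      IsCompletelyRegular ((codeA H : Submodule F (Fin nA → F)) : Set (Fin nA → F)) 2 b c)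
    -- B has covering radius 2
    (hρB : (∀ x, distToCode ((codeB H : Submodule F (Fin nB → F)) : Set (Fin nB → F)) x ≤ 2) ∧
      (∃ x, distToCode ((codeB H : Submodule F (Fin nB → F)) : Set (Fin nB → F)) x = 2)) :
    Module.finrank F (codeB H) = nB - m := by
  set GA : Matrix (Fin m) (Fin nA) F := Matrix.of fun i j => H i (Sum.inl j)
  set GB : Matrix (Fin m) (Fin nB) F := Matrix.of fun i j => H i (Sum.inr j)
  have hAker : codeA H = LinearMap.ker GA.mulVecLin := rfl
  have hBker : codeB H = LinearMap.ker GB.mulVecLin := rfl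
  rw [hAker] at hCRA
  rw [hBker] at hρB ⊢
  suffices hrange : LinearMap.range GB.mulVecLin = ⊤ by
    have h := LinearMap.finrank_range_add_finrank_ker GB.mulVecLin
    rw [hrange, finrank_top, Module.finrank_fin_fun, Module.finrank_fin_fun] at h
    omega
  by_contra hW
  obtain ⟨u, -, hu⟩ := SetLike.exists_of_lt (lt_top_iff_ne_top.2 hW)
  set W := LinearMap.range GB.mulVecLin
  obtain ⟨b, c, hle, -, hreg⟩ := hCRA
  obtain ⟨-, x, hx⟩ := hρB
  obtain ⟨s, t, hs, ht, hst⟩ := exists_add_not_multiple_of_distToCode hB GB (x := x) (by omega)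
  set PA : (Fin m → F) → Prop := fun v => ∃ j, ∃ a : F, v = fun i => a * GA i j
  set PB : (Fin m → F) → Prop := fun v => ∃ j, ∃ a : F, v = fun i => a * GB i j
  have hA0 : PA 0 := ⟨⟨0, hA⟩, 0, by funext i; simp⟩
  have hB0 : PB 0 := ⟨⟨0, hB⟩, 0, by funext i; simp⟩
  have hAB : ∀ v, PA v ∨ PB v := by
    intro v
    by_cases hv : v = 0
    · exact Or.inl (hv ▸ hA0)
    · obtain ⟨j | j, a, h⟩ := hmax v hv
      · exact Or.inl ⟨j, a, h⟩
      · exact Or.inr ⟨j, a, h⟩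
  have hdisj : ∀ v, PA v → PB v → v = 0 := by
    rintro v ⟨j, a, rfl⟩ ⟨k, d, h⟩
    by_cases hd : d = 0
    · rw [h, hd]; funext i; simp
    · refine absurd ?_ (hindep (Sum.inl j) (Sum.inr k) (by simp) (d⁻¹ * a))
      funext i
      have hi : a * H i (Sum.inl j) = d * H i (Sum.inr k) := congrFun h i
      rw [mul_assoc, hi, inv_mul_cancel_left₀ hd]
  have hPBW : ∀ v, PB v → v ∈ W := by
    rintro v ⟨j, a, rfl⟩
    exact ⟨Pi.single j a, mulVec_single_eq GB j a⟩
  have hPBneg : ∀ v, PB v → PB (-v) := by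
    rintro v ⟨j, a, rfl⟩
    exact ⟨j, -a, by funext i; simp⟩
  have hinj := mulVec_injOn_sphere GA (fun j => hcols (Sum.inl j))
    (fun j k hjk => hindep (Sum.inl j) (Sum.inl k) (by simpa using hjk))
  set T : Set (Fin m → F) := {v | PB v ∧ v ≠ 0}
  have hdist2 : ∀ y, distToCode (LinearMap.ker GA.mulVecLin : Set (Fin nA → F)) y = 2 ↔
      GA.mulVec y ∈ T := by
    intro y
    have h1 := distToCode_le_one_iff hA GA y
    have h2 := hle y
    constructor
    · intro h
      have hn : ¬ PA (GA.mulVec y) := fun h' => by have := h1.2 h'; omega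
      exact ⟨(hAB _).resolve_left hn, fun h0 => hn (h0 ▸ hA0)⟩
    · rintro ⟨hb, h0⟩
      have hn := mt h1.1 fun h' => h0 (hdisj _ h' hb)
      omega
  -- The intersection number `b 1` counts neighbours by their syndromes.
  have hcount : ∀ v, ¬ PB v → ∃ y, GA.mulVec y = v ∧
      (GA.mulVec '' {z | hammingDist y z = 1 ∧ GA.mulVec z ∈ T}).ncard = b 1 := by
    intro v hv
    obtain ⟨j, a, h⟩ := (hAB v).resolve_right hv
    have hy : GA.mulVec (Pi.single j a) = v := (mulVec_single_eq GA j a).trans h.symm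
    refine ⟨Pi.single j a, hy, ?_⟩
    have h1 := (distToCode_le_one_iff hA GA (Pi.single j a)).2 ⟨j, a, hy.trans h⟩
    have h0 := mt (distToCode_eq_zero_iff GA (Pi.single j a)).1
      fun h0 => hv (by rw [← hy, h0]; exact hB0)
    have hb := (hreg 1 one_le_two (Pi.single j a) (by omega)).1
    rw [Set.InjOn.ncard_image ((hinj _).mono fun z hz => hz.1), ← hb, Nat.card_coe_set_eq]
    simp only [Nat.reduceAdd, hdist2]
  have huB : ¬ PB u := fun h => hu (hPBW u h)
  obtain ⟨y, hy, hyb⟩ := hcount u huB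
  have hfull : T ⊆ GA.mulVec '' {z | hammingDist y z = 1 ∧ GA.mulVec z ∈ T} := by
    intro v hv
    have hvW := hPBW v hv.1
    have hnW : v - u ∉ W := fun h => hu (by simpa using W.sub_mem hvW h)
    obtain ⟨j, a, h⟩ := (hAB (v - u)).resolve_right fun h => hnW (hPBW _ h)
    have ha : a ≠ 0 := by
      rintro rfl
      refine hnW ?_
      rw [h]
      convert W.zero_mem using 1
      funext i
      simp
    have hz : GA.mulVec (y + Pi.single j a) = v := by
      rw [Matrix.mulVec_add, hy, mulVec_single_eq, ← h, add_sub_cancel]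
    exact ⟨_, ⟨hammingDist_add_single y ha, hz.symm ▸ hv⟩, hz⟩
  obtain ⟨z, hz, hzb⟩ := hcount (s + t) hst
  have hs0 : s ≠ 0 := by
    rintro rfl
    exact hst (by simpa using ht)
  have ht0 : t ≠ 0 := by
    rintro rfl
    exact hst (by simpa using hs)
  have hmiss : GA.mulVec '' {w | hammingDist z w = 1 ∧ GA.mulVec w ∈ T} ⊂ T := by
    refine (Set.ssubset_iff_of_subset ?_).2 ⟨s, ⟨hs, hs0⟩, ?_⟩
    · rintro _ ⟨w, hw, rfl⟩
      exact hw.2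
    · rintro ⟨w, ⟨hw, -⟩, hws⟩
      obtain ⟨j, a, -, rfl⟩ := exists_single_of_hammingDist_eq_one hw
      rw [Matrix.mulVec_add, hz, mulVec_single_eq] at hws
      have hneg : -t = fun i => a * GA i j := by
        rw [add_assoc, add_eq_left] at hws
        exact neg_eq_of_add_eq_zero_right hws
      exact ht0 (neg_eq_zero.1 (hdisj (-t) ⟨j, a, hneg⟩ (hPBneg t ht)))
  have hlt := Set.ncard_lt_ncard hmiss T.toFinite
  have hge := Set.ncard_le_ncard hfull (Set.toFinite _)
  omega
end

section
/- With A and B supplementary completely regular codes of covering radius 2 inside the Hamming code parity-check matrix, and b_1, b_1' the respective intersection numbers counting neighbors at distance 2 of weight-one vectors, the relation b_1 n_A + b_1' n_B = (q-1) n_A n_B holds. Consequently B has intersection array {(q-1)n_B, (q-1)n_A - (n_A/n_B) b_1; 1, (q-1)n_B - b_1}. -/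
open Finset in
/-- Two disjoint symmetric sets `S`, `T` partitioning the nonzero elements of a finite group: if
every `u ∈ S` leads to `T` by `β` translations in `S`, and every `u ∈ T` leads to `S` by `β'`
translations in `T`, then the pairs in `S ×ˢ T` are counted by `β * #S + β' * #T`. -/
theorem card_mul_add_card_mul_of_partition {V : Type*} [AddCommGroup V] [DecidableEq V]
    {S T : Finset V} (hST : Disjoint S T) (hcover : ∀ v, v ∈ S ∨ v ∈ T ↔ v ≠ 0)
    (hS : ∀ v ∈ S, -v ∈ S) {β β' : ℕ}
    (hβ : ∀ u ∈ S, #{t ∈ S | u + t ∈ T} = β) (hβ' : ∀ u ∈ T, #{t ∈ T | u + t ∈ S} = β') :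
    β * #S + β' * #T = #S * #T := by
  have h₁ : β * #S = #{p ∈ S ×ˢ T | p.2 - p.1 ∈ S} := by
    rw [mul_comm, ← smul_eq_mul, ← sum_const, card_eq_sum_card_fiberwise (f := Prod.fst) (t := S)
      (fun p hp => by simp at hp ⊢; exact hp.1.1)]
    refine sum_congr rfl fun u hu => ?_
    rw [← hβ u hu]
    refine card_bij' (fun t _ => (u, u + t)) (fun p _ => p.2 - p.1) ?_ ?_ ?_ ?_
    · simp +contextual [hu]
    · rintro ⟨a, b⟩ h
      simp only [mem_filter, mem_product] at h ⊢
      obtain ⟨⟨⟨-, hb⟩, hs⟩, rfl⟩ := h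
      simpa [hs] using hb
    · simp
    · rintro ⟨a, b⟩ h
      simp only [mem_filter, mem_product] at h
      obtain ⟨-, rfl⟩ := h
      simp
  have h₂ : β' * #T = #{p ∈ S ×ˢ T | ¬ p.2 - p.1 ∈ S} := by
    rw [mul_comm, ← smul_eq_mul, ← sum_const, card_eq_sum_card_fiberwise (f := Prod.snd) (t := T)
      (fun p hp => by simp at hp ⊢; exact hp.1.2)]
    refine sum_congr rfl fun u hu => ?_
    rw [← hβ' u hu]
    refine card_bij' (fun t _ => (u + t, u)) (fun p _ => p.1 - p.2) ?_ ?_ ?_ ?_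
    · intro t ht
      simp only [mem_filter, mem_product] at ht ⊢
      refine ⟨⟨⟨ht.2, hu⟩, fun h => disjoint_left.1 hST (hS _ h) ?_⟩, trivial⟩
      simpa using ht.1
    · rintro ⟨a, b⟩ h
      simp only [mem_filter, mem_product] at h ⊢
      obtain ⟨⟨⟨ha, -⟩, hs⟩, rfl⟩ := h
      refine ⟨((hcover (a - b)).2 ?_).resolve_left fun h => hs ?_, by simpa using ha⟩
      · exact sub_ne_zero.2 fun h => disjoint_left.1 hST ha (h ▸ hu)
      · simpa using hS _ h
    · simp
    · rintro ⟨a, b⟩ h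
      simp only [mem_filter, mem_product] at h
      obtain ⟨-, rfl⟩ := h
      simp
  rw [h₁, h₂, card_filter_add_card_filter_not, card_product]

open Finset in
theorem card_filter_add_mem_add_eq_card {V : Type*} [AddCommGroup V] [DecidableEq V]
    {S T : Finset V} (hST : Disjoint S T) (hcover : ∀ v, v ∈ S ∨ v ∈ T ↔ v ≠ 0)
    (hS : ∀ v ∈ S, -v ∈ S) (hT : ∀ v ∈ T, -v ∈ T) {u : V} (hu : u ∈ S) :
    #{t ∈ T | u + t ∈ T} + #{t ∈ S | u + t ∈ T} = #T := by
  have h : #{t ∈ S | u + t ∈ T} = #{t ∈ T | ¬ u + t ∈ T} := by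
    refine card_bij' (fun t _ => -(u + t)) (fun t _ => -(u + t)) ?_ ?_ ?_ ?_
    · intro t ht
      simp only [mem_filter] at ht ⊢
      refine ⟨hT _ ht.2, fun h => disjoint_left.1 hST (hS _ ht.1) ?_⟩
      simpa using h
    · intro t ht
      simp only [mem_filter] at ht ⊢
      refine ⟨hS _ (((hcover (u + t)).2 fun h => ?_).resolve_right ht.2), by simpa using hT _ ht.1⟩
      exact disjoint_left.1 hST (hS _ hu) (neg_eq_of_add_eq_zero_right h ▸ ht.1)
    · simp
    · simp
  rw [h, card_filter_add_card_filter_not]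

theorem hammingDist_eq_one_iff {ι F : Type*} [Fintype ι] [DecidableEq ι] [AddGroup F]
    [DecidableEq F] {x y : ι → F} :
    hammingDist x y = 1 ↔ ∃ j a, a ≠ 0 ∧ y = x + Pi.single j a := by
  constructor
  · intro h
    obtain ⟨j, hj⟩ := Finset.card_eq_one.1 h
    have hj' : ∀ i, x i ≠ y i ↔ i = j := fun i => by
      simpa using congrArg (i ∈ ·) hj
    refine ⟨j, -x j + y j, fun h => (hj' j).2 rfl ?_, ?_⟩
    · exact (neg_add_eq_zero.1 h)
    · ext i
      by_cases hi : i = j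
      · subst hi; simp
      · simpa [hi] using (not_not.1 (mt (hj' i).1 hi)).symm
  · rintro ⟨j, a, ha, rfl⟩
    refine Finset.card_eq_one.2 ⟨j, ?_⟩
    ext i
    by_cases hi : i = j
    · subst hi; simpa using ha
    · simp [hi]

section Syndrome

variable {F V : Type} [Field F] [Fintype F] [DecidableEq F] [AddCommGroup V] [Module F V]
  {n : ℕ}

theorem distToCode_ker_eq_zero_iff {φ : (Fin n → F) →ₗ[F] V} {x : Fin n → F} :
    distToCode (LinearMap.ker φ : Set (Fin n → F)) x = 0 ↔ φ x = 0 := by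
  rw [distToCode, Nat.sInf_eq_zero]
  constructor
  · rintro (⟨y, hy, h⟩ | h)
    · rw [hammingDist_eq_zero.1 h]; exact hy
    · exact absurd h (Set.Nonempty.ne_empty ⟨_, 0, by simp, rfl⟩)
  · exact fun h => Or.inl ⟨x, h, hammingDist_self x⟩

variable [DecidableEq V]

/-- The syndromes of the weight-one vectors. -/
def weightOneSyndromes (φ : (Fin n → F) →ₗ[F] V) : Finset V :=
  Finset.univ.image fun p : Fin n × Fˣ => φ (Pi.single p.1 (p.2 : F))

theorem mem_weightOneSyndromes {φ : (Fin n → F) →ₗ[F] V} {v : V} :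
    v ∈ weightOneSyndromes φ ↔ ∃ j a, a ≠ 0 ∧ φ (Pi.single j a) = v := by
  simp only [weightOneSyndromes, Finset.mem_image, Finset.mem_univ, true_and, Prod.exists]
  exact ⟨fun ⟨j, a, h⟩ => ⟨j, a, a.ne_zero, h⟩, fun ⟨j, a, ha, h⟩ => ⟨j, Units.mk0 a ha, h⟩⟩

theorem neg_mem_weightOneSyndromes {φ : (Fin n → F) →ₗ[F] V} {v : V}
    (hv : v ∈ weightOneSyndromes φ) : -v ∈ weightOneSyndromes φ := by
  obtain ⟨j, a, ha, rfl⟩ := mem_weightOneSyndromes.1 hv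
  exact mem_weightOneSyndromes.2 ⟨j, -a, neg_ne_zero.2 ha, by rw [Pi.single_neg, map_neg]⟩

theorem card_weightOneSyndromes {φ : (Fin n → F) →ₗ[F] V}
    (hφ : Function.Injective fun p : Fin n × Fˣ => φ (Pi.single p.1 (p.2 : F))) :
    (weightOneSyndromes φ).card = n * (Fintype.card F - 1) := by
  rw [weightOneSyndromes, Finset.card_image_of_injective _ hφ, Finset.card_univ,
    Fintype.card_prod, Fintype.card_fin, Fintype.card_units]

theorem natCard_neighbours {φ : (Fin n → F) →ₗ[F] V}
    (hφ : Function.Injective fun p : Fin n × Fˣ => φ (Pi.single p.1 (p.2 : F)))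
    (x : Fin n → F) (P : V → Prop) [DecidablePred P] :
    Nat.card {y : Fin n → F | hammingDist x y = 1 ∧ P (φ y)} =
      ((weightOneSyndromes φ).filter fun t => P (φ x + t)).card := by
  have himage : (((weightOneSyndromes φ).filter fun t => P (φ x + t) : Finset V) : Set V) =
      (fun y => φ y - φ x) '' {y : Fin n → F | hammingDist x y = 1 ∧ P (φ y)} := by
    ext t
    simp only [Finset.coe_filter, Set.mem_ofPred_eq, mem_weightOneSyndromes, Set.mem_image,
      hammingDist_eq_one_iff]
    constructor
    · rintro ⟨⟨j, a, ha, rfl⟩, h⟩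
      exact ⟨_, ⟨⟨j, a, ha, rfl⟩, by rwa [map_add]⟩, by simp⟩
    · rintro ⟨_, ⟨⟨j, a, ha, rfl⟩, h⟩, rfl⟩
      exact ⟨⟨j, a, ha, by simp⟩, by simpa using h⟩
  rw [Nat.card_coe_set_eq, ← Set.ncard_coe_finset, himage, Set.InjOn.ncard_image]
  rintro y ⟨hy, -⟩ z ⟨hz, -⟩ h
  obtain ⟨j, a, ha, rfl⟩ := hammingDist_eq_one_iff.1 hy
  obtain ⟨k, b, hb, rfl⟩ := hammingDist_eq_one_iff.1 hz
  have := @hφ (j, Units.mk0 a ha) (k, Units.mk0 b hb) (by simpa using h)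
  simp_all [Units.ext_iff]

theorem distToCode_ker_eq_one_iff {φ : (Fin n → F) →ₗ[F] V} (h0 : 0 ∉ weightOneSyndromes φ)
    {x : Fin n → F} : distToCode (LinearMap.ker φ : Set (Fin n → F)) x = 1 ↔
      φ x ∈ weightOneSyndromes φ := by
  constructor
  · intro h
    have hne : (hammingDist x '' (LinearMap.ker φ : Set (Fin n → F))).Nonempty :=
      ⟨_, 0, by simp, rfl⟩
    obtain ⟨y, hy, hxy⟩ := Nat.sInf_mem hne
    obtain ⟨j, a, ha, rfl⟩ := hammingDist_eq_one_iff.1 (hxy.trans h)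
    have hy : φ x + φ (Pi.single j a) = 0 := by simpa using hy
    rw [eq_neg_of_add_eq_zero_left hy]
    exact neg_mem_weightOneSyndromes (mem_weightOneSyndromes.2 ⟨j, a, ha, rfl⟩)
  · intro h
    refine le_antisymm ?_ (Nat.one_le_iff_ne_zero.2 fun h' => h0 ?_)
    · obtain ⟨j, a, ha, hx⟩ := mem_weightOneSyndromes.1 (neg_mem_weightOneSyndromes h)
      exact Nat.sInf_le ⟨x + Pi.single j a, by simp [hx],
        hammingDist_eq_one_iff.2 ⟨j, a, ha, rfl⟩⟩
    · rwa [← distToCode_ker_eq_zero_iff.1 h']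

/-- The intersection numbers `b 1` and `c 2` of a completely regular code of covering radius 2,
read off from the syndromes of weight-one vectors. -/
theorem IsCompletelyRegular.card_filter_syndromes {φ : (Fin n → F) →ₗ[F] V} {T : Finset V}
    (hφ : Function.Injective fun p : Fin n × Fˣ => φ (Pi.single p.1 (p.2 : F)))
    (hST : Disjoint (weightOneSyndromes φ) T)
    (hcover : ∀ v, v ∈ weightOneSyndromes φ ∨ v ∈ T ↔ v ≠ 0) {b c : ℕ → ℕ}
    (h : IsCompletelyRegular (LinearMap.ker φ : Set (Fin n → F)) 2 b c) :
    (∀ u ∈ weightOneSyndromes φ,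
      ((weightOneSyndromes φ).filter fun t => u + t ∈ T).card = b 1) ∧
    ∃ u ∈ T, ((weightOneSyndromes φ).filter fun t => u + t ∈ weightOneSyndromes φ).card = c 2 := by
  obtain ⟨hle, ⟨z, hz⟩, hreg⟩ := h
  have h0 : 0 ∉ weightOneSyndromes φ := fun h => (hcover 0).1 (Or.inl h) rfl
  have htwo : ∀ x, distToCode (LinearMap.ker φ : Set (Fin n → F)) x = 2 ↔ φ x ∈ T := by
    intro x
    have h1 := distToCode_ker_eq_zero_iff (φ := φ) (x := x)
    have h2 := distToCode_ker_eq_one_iff h0 (x := x)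
    have h3 := hcover (φ x)
    have h4 : φ x ∈ weightOneSyndromes φ → φ x ∉ T := fun h => Finset.disjoint_left.1 hST h
    have h5 := hle x
    have h6 : distToCode (LinearMap.ker φ : Set (Fin n → F)) x = 2 ↔
      ¬ distToCode (LinearMap.ker φ : Set (Fin n → F)) x = 0 ∧
      ¬ distToCode (LinearMap.ker φ : Set (Fin n → F)) x = 1 := by omega
    rw [h6, h1, h2]
    tauto
  refine ⟨fun u hu => ?_, φ z, (htwo z).1 hz, ?_⟩
  · obtain ⟨j, a, ha, rfl⟩ := mem_weightOneSyndromes.1 hu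
    rw [← (hreg 1 one_le_two _ ((distToCode_ker_eq_one_iff h0).2 hu)).1,
      ← natCard_neighbours hφ _ (· ∈ T)]
    simp only [Nat.reduceAdd, htwo]
  · rw [← (hreg 2 le_rfl z hz).2 one_le_two,
      ← natCard_neighbours hφ _ (· ∈ weightOneSyndromes φ)]
    simp only [Nat.add_one_sub_one, distToCode_ker_eq_one_iff h0]

end Syndrome

/-- with `A` and `B` supplementary completely regular codes of
covering radius 2, intersection numbers `b₁` and `b₁'` counting neighbours at
distance 2 of weight-one vectors, one has `b₁ n_A + b₁' n_B = (q-1) n_A n_B`;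
consequently `B` has intersection array
`{(q-1)n_B, (q-1)n_A - (n_A/n_B) b₁; 1, (q-1)n_B - b₁}`. -/
theorem supplementary_intersection_array
    {F : Type} [Field F] [Fintype F] [DecidableEq F]
    (q m nA nB : ℕ) (hq : Fintype.card F = q) (hm : 1 < m)
    (hA : 1 ≤ nA) (hB : 1 ≤ nB)
    (hn : (nA + nB) * (q - 1) = q ^ m - 1)
    (H : Matrix (Fin m) (Fin nA ⊕ Fin nB) F)
    (hcols : ∀ j, (fun i => H i j) ≠ 0)
    (hindep : ∀ j k, j ≠ k → ∀ a : F, (fun i => a * H i j) ≠ (fun i => H i k))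
    (hmax : ∀ v : Fin m → F, v ≠ 0 → ∃ j, ∃ a : F, v = fun i => a * H i j)
    (hdimA : Module.finrank F (codeA H) = nA - m)
    (hdimB : Module.finrank F (codeB H) = nB - m)
    (b c b' c' : ℕ → ℕ)
    (hCRA : IsCompletelyRegular
      ((codeA H : Submodule F (Fin nA → F)) : Set (Fin nA → F)) 2 b c)
    (hCRB : IsCompletelyRegular
      ((codeB H : Submodule F (Fin nB → F)) : Set (Fin nB → F)) 2 b' c')
    -- intersection arrays {(q-1)n_A, b 1; 1, c 2} and {(q-1)n_B, b' 1; 1, c' 2}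
    (hb0 : b 0 = (q - 1) * nA) (hc1 : c 1 = 1)
    (hb0' : b' 0 = (q - 1) * nB) (hc1' : c' 1 = 1) :
    b 1 * nA + b' 1 * nB = (q - 1) * nA * nB ∧
      b' 1 * nB = (q - 1) * nA * nB - nA * b 1 ∧
      c' 2 = (q - 1) * nB - b 1 := by
  classical
  set φ := Matrix.mulVecLin (Matrix.of fun i j => H i (Sum.inl j)) with hφ
  set ψ := Matrix.mulVecLin (Matrix.of fun i j => H i (Sum.inr j)) with hψ
  have hφs : ∀ j a, φ (Pi.single j a) = fun i => a * H i (Sum.inl j) := by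
    intro j a; ext i; simp [hφ, mul_comm]
  have hψs : ∀ j a, ψ (Pi.single j a) = fun i => a * H i (Sum.inr j) := by
    intro j a; ext i; simp [hψ, mul_comm]
  have hinj : ∀ j k, ∀ a b : F, a ≠ 0 → b ≠ 0 →
      (fun i => a * H i j) = (fun i => b * H i k) → j = k ∧ a = b := by
    intro j k a b ha hb h
    have hjk : j = k := by
      by_contra hjk
      refine hindep j k hjk (b⁻¹ * a) (funext fun i => ?_)
      rw [mul_assoc, congrFun h i, inv_mul_cancel_left₀ hb]
    subst hjk
    obtain ⟨i, hi⟩ := Function.ne_iff.1 (hcols j)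
    exact ⟨rfl, mul_right_cancel₀ hi (congrFun h i)⟩
  have hφinj : Function.Injective fun p : Fin nA × Fˣ => φ (Pi.single p.1 (p.2 : F)) := by
    rintro ⟨j, a⟩ ⟨k, b⟩ h
    simp only [hφs] at h
    obtain ⟨h₁, h₂⟩ := hinj _ _ _ _ a.ne_zero b.ne_zero h
    exact Prod.ext (Sum.inl_injective h₁) (Units.ext h₂)
  have hψinj : Function.Injective fun p : Fin nB × Fˣ => ψ (Pi.single p.1 (p.2 : F)) := by
    rintro ⟨j, a⟩ ⟨k, b⟩ h
    simp only [hψs] at h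
    obtain ⟨h₁, h₂⟩ := hinj _ _ _ _ a.ne_zero b.ne_zero h
    exact Prod.ext (Sum.inr_injective h₁) (Units.ext h₂)
  have hdisj : Disjoint (weightOneSyndromes φ) (weightOneSyndromes ψ) := by
    refine Finset.disjoint_left.2 fun v hv hv' => ?_
    obtain ⟨j, a, ha, rfl⟩ := mem_weightOneSyndromes.1 hv
    obtain ⟨k, b, hb, h⟩ := mem_weightOneSyndromes.1 hv'
    rw [hφs, hψs] at h
    exact Sum.inr_ne_inl (hinj _ _ _ _ hb ha h).1
  have hne : ∀ j, ∀ a : F, a ≠ 0 → (fun i => a * H i j) ≠ 0 := fun j a ha h => by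
    obtain ⟨i, hi⟩ := Function.ne_iff.1 (hcols j)
    exact mul_ne_zero ha hi (congrFun h i)
  have hcover : ∀ v, v ∈ weightOneSyndromes φ ∨ v ∈ weightOneSyndromes ψ ↔ v ≠ 0 := by
    intro v
    simp only [mem_weightOneSyndromes, hφs, hψs]
    constructor
    · rintro (⟨j, a, ha, rfl⟩ | ⟨j, a, ha, rfl⟩) <;> exact hne _ a ha
    · intro hv
      obtain ⟨j, a, rfl⟩ := hmax v hv
      have ha : a ≠ 0 := by
        rintro rfl
        exact hv (funext fun i => zero_mul _)
      rcases j with j | j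
      · exact Or.inl ⟨j, a, ha, rfl⟩
      · exact Or.inr ⟨j, a, ha, rfl⟩
  obtain ⟨hb1, -⟩ := IsCompletelyRegular.card_filter_syndromes hφinj hdisj hcover hCRA
  obtain ⟨hb1', u, hu, hc2⟩ := IsCompletelyRegular.card_filter_syndromes hψinj hdisj.symm
    (fun v => or_comm.trans (hcover v)) hCRB
  have hq1 : 0 < q - 1 := by
    have := Fintype.one_lt_card (α := F)
    omega
  have hmain := card_mul_add_card_mul_of_partition hdisj hcover
    (fun _ => neg_mem_weightOneSyndromes) hb1 hb1'
  have hcount := card_filter_add_mem_add_eq_card hdisj hcover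
    (fun _ => neg_mem_weightOneSyndromes) (fun _ => neg_mem_weightOneSyndromes) hu
  rw [hb1 u hu, hc2, card_weightOneSyndromes hψinj, hq, mul_comm] at hcount
  rw [card_weightOneSyndromes hφinj, card_weightOneSyndromes hψinj, hq] at hmain
  have hrel : b 1 * nA + b' 1 * nB = (q - 1) * nA * nB :=
    Nat.eq_of_mul_eq_mul_right hq1 (by linear_combination hmain)
  exact ⟨hrel, by rw [← hrel, mul_comm nA, Nat.add_sub_cancel_left], by omega⟩
end
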